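/- Let γ_0,…,γ_{k−1} and δ_1,…,δ_{k−1} be positive reals and let T_k = L_k D_k L_k^T be the Jacobi matrix built from them (L_k unit lower bidiagonal with subdiagonal √δ_1,…,√δ_{k−1}, D_k = diag(γ_0^{−1},…,γ_{k−1}^{−1})). Then: (i) the i-th component of T_k^{−1} e_k equals (−1)^{k−i} γ_{k−1} Π_{j=i}^{k−1} √δ_j (with the empty product for i = k equal to 1); (ii) e_k^T T_k^{−1} e_k = γ_{k−1}; and (iii) e_k^T T_k^{−2} e_k = γ_{k−1}² Σ_{i=1}^{k} Π_{j=i}^{k−1} δ_j = γ_{k−1}²/φ_{k−1}, where φ_0 = 1 and φ_j^{−1} = 1 + φ_{j−1}^{−1} δ_j for j = 1,…,k−1. -/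

import Mathlib

open Matrix Finset

theorem Fin.prod_filter_castSucc_le {k : ℕ} (f : Fin k → ℝ) (i : Fin k) :
    ∏ j ∈ Finset.univ.filter (fun j : Fin k => ((i.castSucc : Fin (k + 1)) : ℕ) ≤ (j : ℕ)), f j =
      f i * ∏ j ∈ Finset.univ.filter (fun j : Fin k => ((i.succ : Fin (k + 1)) : ℕ) ≤ (j : ℕ)),
        f j := by
  have h : Finset.univ.filter (fun j : Fin k => ((i.castSucc : Fin (k + 1)) : ℕ) ≤ (j : ℕ)) =
      insert i (Finset.univ.filter
        (fun j : Fin k => ((i.succ : Fin (k + 1)) : ℕ) ≤ (j : ℕ))) := by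
    ext j
    simp only [Finset.mem_filter, Finset.mem_univ, true_and, Finset.mem_insert,
      Fin.val_castSucc, Fin.val_succ, Fin.ext_iff]
    omega
  rw [h, Finset.prod_insert (by simp)]

theorem Fin.filter_last_le (k : ℕ) :
    Finset.univ.filter (fun j : Fin k => ((Fin.last k : Fin (k + 1)) : ℕ) ≤ (j : ℕ)) = ∅ := by
  ext j
  simp

/-- The recursion `u (j + 1) = 1 + u j * δ j`, `u 0 = 1` is solved by a sum of tail products. -/
theorem sum_tail_prod_eq_of_recursion (k : ℕ) (δ : Fin k → ℝ) (u : Fin (k + 1) → ℝ)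
    (h0 : u 0 = 1) (hu : ∀ j : Fin k, u j.succ = 1 + u j.castSucc * δ j) :
    ∑ i : Fin (k + 1), ∏ j ∈ Finset.univ.filter (fun j : Fin k => (i : ℕ) ≤ (j : ℕ)), δ j =
      u (Fin.last k) := by
  induction k with
  | zero => simpa using h0.symm
  | succ k ih =>
    have ih' := ih (fun j => δ j.castSucc) (fun j => u j.castSucc) h0
      (fun j => hu j.castSucc)
    rw [Fin.sum_univ_castSucc, Fin.filter_last_le, Finset.prod_empty, ← Fin.succ_last,
      hu, ← ih', Finset.sum_mul, add_comm]
    congr 1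
    refine Finset.sum_congr rfl fun i _ => ?_
    rw [Finset.prod_filter, Fin.prod_univ_castSucc, Finset.prod_filter]
    simp [Fin.is_le i]

/-- Entries of `Lᵀ x` for a unit lower bidiagonal matrix `L`. -/
theorem transpose_bidiagonal_mulVec_castSucc {k : ℕ} (L : Matrix (Fin (k + 1)) (Fin (k + 1)) ℝ)
    (hLdiag : ∀ i, L i i = 1)
    (hLzero : ∀ i j : Fin (k + 1), (i : ℕ) ≠ (j : ℕ) → (i : ℕ) ≠ (j : ℕ) + 1 → L i j = 0)
    (x : Fin (k + 1) → ℝ) (i : Fin k) :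
    (Lᵀ *ᵥ x) i.castSucc = x i.castSucc + L i.succ i.castSucc * x i.succ := by
  have hne : i.castSucc ≠ i.succ := (Fin.castSucc_lt_succ).ne
  simp only [Matrix.mulVec, dotProduct, Matrix.transpose_apply]
  rw [Finset.sum_eq_add i.castSucc i.succ hne _ (by simp) (by simp), hLdiag, one_mul]
  rintro j - ⟨h1, h2⟩
  rw [hLzero j _ (fun h => h1 (Fin.ext h)) (fun h => h2 (Fin.ext (by simpa using h))), zero_mul]

theorem transpose_bidiagonal_mulVec_last {k : ℕ} (L : Matrix (Fin (k + 1)) (Fin (k + 1)) ℝ)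
    (hLdiag : ∀ i, L i i = 1)
    (hLzero : ∀ i j : Fin (k + 1), (i : ℕ) ≠ (j : ℕ) → (i : ℕ) ≠ (j : ℕ) + 1 → L i j = 0)
    (x : Fin (k + 1) → ℝ) :
    (Lᵀ *ᵥ x) (Fin.last k) = x (Fin.last k) := by
  simp only [Matrix.mulVec, dotProduct, Matrix.transpose_apply]
  rw [Finset.sum_eq_single (Fin.last k) _ (by simp), hLdiag, one_mul]
  intro j _ h
  rw [hLzero j _ (fun e => h (Fin.ext e)) (by have := j.isLt; simp only [Fin.val_last]; omega),
    zero_mul]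

theorem bidiagonal_mulVec_single_last {k : ℕ} (L : Matrix (Fin (k + 1)) (Fin (k + 1)) ℝ)
    (hLdiag : ∀ i, L i i = 1)
    (hLzero : ∀ i j : Fin (k + 1), (i : ℕ) ≠ (j : ℕ) → (i : ℕ) ≠ (j : ℕ) + 1 → L i j = 0) :
    L *ᵥ Pi.single (Fin.last k) 1 = Pi.single (Fin.last k) 1 := by
  ext i
  rw [Matrix.mulVec_single_one, Matrix.col_apply]
  by_cases h : i = Fin.last k
  · subst h
    rw [hLdiag, Pi.single_eq_same]
  · rw [Pi.single_eq_of_ne h]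
    exact hLzero i _ (fun e => h (Fin.ext e))
      (by have := i.isLt; simp only [Fin.val_last]; omega)

/-- for the CG Jacobi matrix `T = L D Lᵀ`:
(i) `(T⁻¹ e)ᵢ = (-1)^{k-i} γ_{k-1} ∏_{j ≥ i} √δ_j`;
(ii) `eᵀ T⁻¹ e = γ_{k-1}`;
(iii) `eᵀ T⁻² e = γ_{k-1}² ∑ᵢ ∏_{j ≥ i} δ_j = γ_{k-1}²/φ_{k-1}`. -/
theorem stmt13
    (k : ℕ) (γ : Fin (k + 1) → ℝ) (δ : Fin k → ℝ)
    (hγ : ∀ i, 0 < γ i) (hδ : ∀ i, 0 < δ i)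
    (L T : Matrix (Fin (k + 1)) (Fin (k + 1)) ℝ)
    (φ : Fin (k + 1) → ℝ)
    (hLdiag : ∀ i, L i i = 1)
    (hLsub : ∀ i : Fin k, L i.succ i.castSucc = Real.sqrt (δ i))
    (hLzero : ∀ i j : Fin (k + 1), (i : ℕ) ≠ (j : ℕ) → (i : ℕ) ≠ (j : ℕ) + 1 → L i j = 0)
    (hT : T = L * Matrix.diagonal (fun i => (γ i)⁻¹) * Lᵀ)
    (hφ0 : φ 0 = 1)
    (hφ : ∀ j : Fin k, (φ j.succ)⁻¹ = 1 + (φ j.castSucc)⁻¹ * δ j) :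
    (∀ i : Fin (k + 1), (T⁻¹ *ᵥ Pi.single (Fin.last k) 1) i
        = (-1) ^ (k - (i : ℕ)) * γ (Fin.last k) *
          ∏ j ∈ Finset.univ.filter (fun j : Fin k => (i : ℕ) ≤ (j : ℕ)), Real.sqrt (δ j)) ∧
    (Pi.single (Fin.last k) 1 ⬝ᵥ T⁻¹ *ᵥ Pi.single (Fin.last k) 1 = γ (Fin.last k)) ∧
    (Pi.single (Fin.last k) 1 ⬝ᵥ (T⁻¹ * T⁻¹) *ᵥ Pi.single (Fin.last k) 1
        = (γ (Fin.last k)) ^ 2 *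
          ∑ i : Fin (k + 1), ∏ j ∈ Finset.univ.filter (fun j : Fin k => (i : ℕ) ≤ (j : ℕ)), δ j ∧
     Pi.single (Fin.last k) 1 ⬝ᵥ (T⁻¹ * T⁻¹) *ᵥ Pi.single (Fin.last k) 1
        = (γ (Fin.last k)) ^ 2 / φ (Fin.last k)) := by
  set e : Fin (k + 1) → ℝ := Pi.single (Fin.last k) 1 with he
  set x : Fin (k + 1) → ℝ := fun i => (-1) ^ (k - (i : ℕ)) * γ (Fin.last k) *
    ∏ j ∈ Finset.univ.filter (fun j : Fin k => (i : ℕ) ≤ (j : ℕ)), Real.sqrt (δ j) with hx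
  have hxlast : x (Fin.last k) = γ (Fin.last k) := by
    simp only [hx]
    rw [Fin.filter_last_le]
    simp
  have hLx : Lᵀ *ᵥ x = Pi.single (Fin.last k) (γ (Fin.last k)) := by
    ext i
    induction i using Fin.lastCases with
    | last =>
      rw [transpose_bidiagonal_mulVec_last L hLdiag hLzero, hxlast, Pi.single_eq_same]
    | cast i =>
      rw [transpose_bidiagonal_mulVec_castSucc L hLdiag hLzero, hLsub,
        Pi.single_eq_of_ne (Fin.castSucc_lt_last i).ne]
      simp only [hx]
      rw [Fin.prod_filter_castSucc_le]
      have hk : k - ((i.castSucc : Fin (k + 1)) : ℕ) =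
          (k - ((i.succ : Fin (k + 1)) : ℕ)) + 1 := by
        have := i.isLt
        simp only [Fin.val_castSucc, Fin.val_succ]
        omega
      rw [hk, pow_succ]
      ring
  have hTx : T *ᵥ x = e := by
    rw [hT, ← Matrix.mulVec_mulVec, ← Matrix.mulVec_mulVec, hLx,
      Matrix.diagonal_mulVec_single, inv_mul_cancel₀ (hγ _).ne',
      bidiagonal_mulVec_single_last L hLdiag hLzero]
  have hdetL : L.det = 1 := by
    rw [Matrix.det_of_isLowerTriangular]
    · simp [hLdiag]
    · intro i j hij
      have h : (i : ℕ) < (j : ℕ) := hij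
      exact hLzero i j (by omega) (by omega)
  have hdet : IsUnit T.det := by
    rw [hT, Matrix.det_mul, Matrix.det_mul, Matrix.det_transpose, hdetL, Matrix.det_diagonal,
      one_mul, mul_one, isUnit_iff_ne_zero]
    exact Finset.prod_ne_zero_iff.mpr fun i _ => inv_ne_zero (hγ i).ne'
  have hinv : T⁻¹ *ᵥ e = x := by
    rw [← hTx, Matrix.mulVec_mulVec, Matrix.nonsing_inv_mul T hdet, Matrix.one_mulVec]
  have hsymm : (T⁻¹)ᵀ = T⁻¹ := by
    rw [Matrix.transpose_nonsing_inv, hT]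
    simp [Matrix.transpose_mul, Matrix.mul_assoc]
  have hsq : e ⬝ᵥ (T⁻¹ * T⁻¹) *ᵥ e = (γ (Fin.last k)) ^ 2 *
      ∑ i : Fin (k + 1), ∏ j ∈ Finset.univ.filter (fun j : Fin k => (i : ℕ) ≤ (j : ℕ)), δ j := by
    rw [← Matrix.mulVec_mulVec, hinv, Matrix.dotProduct_mulVec, ← Matrix.mulVec_transpose, hsymm,
      hinv, dotProduct, Finset.mul_sum]
    refine Finset.sum_congr rfl fun i _ => ?_
    have hprod : ∏ j ∈ Finset.univ.filter (fun j : Fin k => (i : ℕ) ≤ (j : ℕ)), δ j =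
        (∏ j ∈ Finset.univ.filter (fun j : Fin k => (i : ℕ) ≤ (j : ℕ)), Real.sqrt (δ j)) ^ 2 := by
      rw [← Finset.prod_pow]
      exact Finset.prod_congr rfl fun j _ => (Real.sq_sqrt (hδ j).le).symm
    have hsign : ((-1 : ℝ) ^ (k - (i : ℕ))) ^ 2 = 1 := by
      rw [← pow_mul, mul_comm, pow_mul, neg_one_sq, one_pow]
    rw [hprod]
    simp only [hx]
    rw [← sq, mul_pow, mul_pow, hsign, one_mul]
  refine ⟨fun i => congrFun hinv i, ?_, hsq, ?_⟩
  · rw [hinv, he, single_one_dotProduct, hxlast]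
  · rw [hsq, sum_tail_prod_eq_of_recursion k δ (fun i => (φ i)⁻¹) (by simp [hφ0]) hφ,
      div_eq_mul_inv]
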